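/- Let G be a connected P4-free simple graph with at least two vertices. Then G has a spanning SBEP subgraph if and only if G is (1/2)-tough. -/

import Mathlib

open SimpleGraph

variable {V : Type*} {W : Type*}

/-- A graph is `P₄`-free if it contains no induced subgraph isomorphic to the
path on four vertices. -/
def P4Free (G : SimpleGraph V) : Prop := IsEmpty (SimpleGraph.pathGraph 4 ↪g G)

/-- `R` is (the vertex set of) a connected component of `G - S`:
a maximal subset of `V(G) - S` inducing a connected subgraph. -/
def IsCompOf (G : SimpleGraph V) (S R : Set V) : Prop :=
  R ⊆ Sᶜ ∧ (G.induce R).Connected ∧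
    ∀ R' : Set V, R ⊆ R' → R' ⊆ Sᶜ → (G.induce R').Connected → R' = R

/-- The number of connected components of `G - S`. -/
noncomputable def numComp (G : SimpleGraph V) (S : Set V) : ℕ :=
  {R : Set V | IsCompOf G S R}.ncard

/-- `S` is a cutset of `G` : the graph `G - S` is disconnected. -/
def IsCutset (G : SimpleGraph V) (S : Set V) : Prop := 2 ≤ numComp G S

/-- `G` is `t`-tough: for every cutset `S`, `t * c(G - S) ≤ |S|`. -/
def Tough (t : ℝ) (G : SimpleGraph V) : Prop :=
  ∀ S : Set V, IsCutset G S → t * (numComp G S : ℝ) ≤ (S.ncard : ℝ)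

/-- `t` is the toughness of `G` : the largest `s` such that `G` is `s`-tough.
(For a complete graph no such largest `s` exists; the toughness is infinite.) -/
def IsToughness (G : SimpleGraph V) (t : ℝ) : Prop :=
  Tough t G ∧ ∀ s : ℝ, Tough s G → s ≤ t

/-- `S` is a tough-set of `G` (whose toughness is `t`): a cutset with
`|S| = t * c(G - S)`. -/
def ToughSet (G : SimpleGraph V) (t : ℝ) (S : Set V) : Prop :=
  IsCutset G S ∧ (S.ncard : ℝ) = t * (numComp G S : ℝ)

/-- Vertex `u` is adjacent in `G` to some vertex of the set `R`. -/
def AdjToSet (G : SimpleGraph V) (u : V) (R : Set V) : Prop := ∃ v ∈ R, G.Adj u v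

/-- `G` has a Hamiltonian cycle. -/
def HasHamCycle [DecidableEq V] (G : SimpleGraph V) : Prop :=
  ∃ (v : V) (w : G.Walk v v), w.IsHamiltonianCycle

/-- `G` has a spanning `k`-walk: a closed walk visiting every vertex at least once
and at most `k` times.  (In a nontrivial closed walk the base vertex occurs one
extra time in `Walk.support`, whence the correction term.) -/
def HasSpanningKWalk [DecidableEq V] (G : SimpleGraph V) (k : ℕ) : Prop :=
  ∃ (v : V) (w : G.Walk v v), (∀ x : V, x ∈ w.support) ∧
    ∀ x : V, w.support.count x ≤ k + (if x = v then 1 else 0)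

/-- The prism over `G`: the Cartesian (box) product `G □ K₂`. -/
def prism (G : SimpleGraph V) : SimpleGraph (V × Fin 2) :=
  G.boxProd (⊤ : SimpleGraph (Fin 2))

/-- The graph obtained from `G` by contracting the set `R` to a single vertex
(namely `Sum.inr ()`), which is adjacent to exactly those vertices outside `R`
having a neighbor in `R`. -/
def contractSet (G : SimpleGraph V) (R : Set V) : SimpleGraph (↥(Rᶜ) ⊕ Unit) :=
  SimpleGraph.fromRel fun x y =>
    match x, y with
    | Sum.inl a, Sum.inl b => G.Adj ↑a ↑b
    | Sum.inl a, Sum.inr _ => ∃ r ∈ R, G.Adj ↑a r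
    | _, _ => False

/-- `v` is a cutvertex of `H` : deleting `v` leaves a disconnected
(non-preconnected) graph. -/
def IsCutvertex (H : SimpleGraph W) (v : W) : Prop :=
  ¬ (H.induce ({v}ᶜ : Set W)).Preconnected

/-- `B` is a block of `H` : a maximal connected subgraph having no cutvertex of
its own. -/
def IsBlock (H : SimpleGraph W) (B : H.Subgraph) : Prop :=
  B.coe.Connected ∧ (∀ v, ¬ IsCutvertex B.coe v) ∧
    ∀ B' : H.Subgraph, B ≤ B' → B'.coe.Connected →
      (∀ v, ¬ IsCutvertex B'.coe v) → B' = B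

/-- `H` is a cycle of even length. -/
def IsEvenCycleGraph (H : SimpleGraph W) : Prop :=
  ∃ n : ℕ, Even n ∧ 3 ≤ n ∧ Nonempty (H ≃g SimpleGraph.cycleGraph n)

/-- `H` is a single edge. -/
def IsSingleEdgeGraph (H : SimpleGraph W) : Prop :=
  ∃ u v : W, u ≠ v ∧ H.Adj u v ∧ ∀ w : W, w = u ∨ w = v

/-- `H` is a simple block EP (SBEP) graph: a connected graph in which every block
is an even cycle or a single edge, and every vertex lies in at most two blocks. -/
def IsSBEP (H : SimpleGraph W) : Prop :=
  H.Connected ∧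
    (∀ B : H.Subgraph, IsBlock H B → IsEvenCycleGraph B.coe ∨ IsSingleEdgeGraph B.coe) ∧
    ∀ (v : W) (B₁ B₂ B₃ : H.Subgraph),
      IsBlock H B₁ ∧ v ∈ B₁.verts → IsBlock H B₂ ∧ v ∈ B₂.verts →
      IsBlock H B₃ ∧ v ∈ B₃.verts → B₁ = B₂ ∨ B₁ = B₃ ∨ B₂ = B₃

/-- `v` is a single-block vertex of `H` : it lies in exactly one block. -/
def SingleBlockVertex (H : SimpleGraph W) (v : W) : Prop :=
  ∃! B : H.Subgraph, IsBlock H B ∧ v ∈ B.verts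


/-- A graph is preconnected iff every nontrivial vertex bipartition is crossed by an edge. -/
lemma preconnected_iff_exists_adj_crossing (H : SimpleGraph W) :
    H.Preconnected ↔ ∀ D : Set W, (∃ x, x ∈ D) → (∃ y, y ∉ D) →
      ∃ x y, x ∈ D ∧ y ∉ D ∧ H.Adj x y := by
  constructor
  · rintro h D ⟨x, hx⟩ ⟨y, hy⟩
    obtain ⟨p⟩ := h x y
    obtain ⟨d, -, h1, h2⟩ := p.exists_boundary_dart D hx hy
    exact ⟨_, _, h1, h2, d.adj⟩
  · intro h u v
    by_contra huv
    obtain ⟨x, y, hx, hy, hxy⟩ := h {z | H.Reachable u z} ⟨u, Reachable.refl u⟩ ⟨v, huv⟩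
    exact hy (Reachable.trans hx hxy.reachable)

/-- Every nontrivial bipartition of the set `N` is crossed by an edge of `H`; equivalently,
`H` induces a preconnected graph on `N`. -/
def CutConn (H : SimpleGraph V) (N : Set V) : Prop :=
  ∀ D : Set V, (∃ x ∈ N, x ∈ D) → (∃ y ∈ N, y ∉ D) →
    ∃ x ∈ N, ∃ y ∈ N, x ∈ D ∧ y ∉ D ∧ H.Adj x y

lemma cutConn_iff (H : SimpleGraph V) (N : Set V) :
    CutConn H N ↔ (H.induce N).Preconnected := by
  rw [preconnected_iff_exists_adj_crossing]
  constructor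
  · rintro h D ⟨x, hx⟩ ⟨y, hy⟩
    obtain ⟨a, ha, b, hb, h1, h2, h3⟩ := h (Subtype.val '' D) ⟨x, x.2, ⟨x, hx, rfl⟩⟩
      ⟨y, y.2, fun ⟨z, hz, hzy⟩ => hy (Subtype.ext hzy ▸ hz)⟩
    obtain ⟨z, hz, rfl⟩ := h1
    exact ⟨z, ⟨b, hb⟩, hz, fun hb' => h2 ⟨_, hb', rfl⟩, h3⟩
  · rintro h D ⟨x, hx, hxD⟩ ⟨y, hy, hyD⟩
    obtain ⟨a, b, h1, h2, h3⟩ := h (Subtype.val ⁻¹' D) ⟨⟨x, hx⟩, hxD⟩ ⟨⟨y, hy⟩, hyD⟩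
    exact ⟨a, a.2, b, b.2, h1, h2, h3⟩

/-- The vertex set `N` stays connected in `H` after deleting at most one vertex. -/
def NonSep (H : SimpleGraph V) (N : Set V) : Prop :=
  CutConn H N ∧ ∀ w, CutConn H (N \ {w})

lemma CutConn.of_coe {H : SimpleGraph V} {B : H.Subgraph} (h : B.coe.Preconnected) :
    CutConn H B.verts := by
  rw [preconnected_iff_exists_adj_crossing] at h
  rintro D ⟨x, hx, hxD⟩ ⟨y, hy, hyD⟩
  obtain ⟨a, b, h1, h2, h3⟩ := h (Subtype.val ⁻¹' D) ⟨⟨x, hx⟩, hxD⟩ ⟨⟨y, hy⟩, hyD⟩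
  exact ⟨a, a.2, b, b.2, h1, h2, B.adj_sub h3⟩

lemma NonSep.of_coe {H : SimpleGraph V} {B : H.Subgraph} (h : B.coe.Preconnected)
    (h' : ∀ v, ¬ IsCutvertex B.coe v) : NonSep H B.verts := by
  refine ⟨.of_coe h, fun w => ?_⟩
  by_cases hw : w ∈ B.verts
  · have := not_not.1 (h' ⟨w, hw⟩)
    rw [← cutConn_iff] at this
    rintro D ⟨x, hx, hxD⟩ ⟨y, hy, hyD⟩
    obtain ⟨a, ha, b, hb, h1, h2, h3⟩ := this (Subtype.val ⁻¹' D)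
      ⟨⟨x, hx.1⟩, fun h => hx.2 (congrArg Subtype.val h), hxD⟩
      ⟨⟨y, hy.1⟩, fun h => hy.2 (congrArg Subtype.val h), hyD⟩
    exact ⟨a, ⟨a.2, fun h => ha (Subtype.ext h)⟩, b, ⟨b.2, fun h => hb (Subtype.ext h)⟩,
      h1, h2, B.adj_sub h3⟩
  · rw [Set.sdiff_singleton_eq_self hw]
    exact .of_coe h

lemma NonSep.not_isCutvertex {H : SimpleGraph V} {N : Set V} (h : NonSep H N) (v : N) :
    ¬ IsCutvertex (H.induce N) v := by
  rw [IsCutvertex, not_not, ← cutConn_iff]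
  rintro D ⟨x, hx, hxD⟩ ⟨y, hy, hyD⟩
  obtain ⟨a, ha, b, hb, h1, h2, h3⟩ := h.2 v (Subtype.val '' D)
    ⟨x, ⟨x.2, fun h => hx (Subtype.ext h)⟩, ⟨x, hxD, rfl⟩⟩
    ⟨y, ⟨y.2, fun h => hy (Subtype.ext h)⟩, fun ⟨z, hz, hzy⟩ => hyD (Subtype.ext hzy ▸ hz)⟩
  obtain ⟨z, hz, rfl⟩ := h1
  exact ⟨z, fun h => ha.2 (congrArg Subtype.val h), ⟨b, hb.1⟩,
    fun h => hb.2 (congrArg Subtype.val h), hz, fun hb' => h2 ⟨_, hb', rfl⟩, h3⟩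

lemma CutConn.mono {H H' : SimpleGraph V} {N : Set V} (h : CutConn H N)
    (hle : ∀ x ∈ N, ∀ y ∈ N, H.Adj x y → H'.Adj x y) : CutConn H' N := by
  intro D h1 h2
  obtain ⟨a, ha, b, hb, h1, h2, h3⟩ := h D h1 h2
  exact ⟨a, ha, b, hb, h1, h2, hle a ha b hb h3⟩

lemma NonSep.mono {H H' : SimpleGraph V} {N : Set V} (h : NonSep H N)
    (hle : ∀ x ∈ N, ∀ y ∈ N, H.Adj x y → H'.Adj x y) : NonSep H' N :=
  ⟨h.1.mono hle, fun w => (h.2 w).mono fun x hx y hy => hle x hx.1 y hy.1⟩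

/-- `𝓑` is the collection of vertex sets of the blocks of an SBEP graph `H` living on the vertex
set `U`, and the vertices of `F` belong to at most one of these blocks. -/
structure BlockSystem (H : SimpleGraph V) (U F : Set V) (𝓑 : Set (Set V)) : Prop where
  adj_mem : ∀ x y, H.Adj x y → x ∈ U
  reachable : ∀ x ∈ U, ∀ y ∈ U, H.Reachable x y
  subset : ∀ B ∈ 𝓑, B ⊆ U
  nonempty : ∀ B ∈ 𝓑, B.Nonempty
  cycle_or_edge : ∀ B ∈ 𝓑, IsEvenCycleGraph (H.induce B) ∨ IsSingleEdgeGraph (H.induce B)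
  nonSep : ∀ B ∈ 𝓑, NonSep H B
  exists_superset : ∀ N : Set V, N.Nontrivial → NonSep H N → ∃ B ∈ 𝓑, N ⊆ B
  two_blocks : ∀ v, ∀ B₁ ∈ 𝓑, ∀ B₂ ∈ 𝓑, ∀ B₃ ∈ 𝓑, v ∈ B₁ → v ∈ B₂ → v ∈ B₃ →
    B₁ = B₂ ∨ B₁ = B₃ ∨ B₂ = B₃
  one_block : ∀ v ∈ F, ∀ B₁ ∈ 𝓑, ∀ B₂ ∈ 𝓑, v ∈ B₁ → v ∈ B₂ → B₁ = B₂

/-- `G` contains an SBEP graph with vertex set `U` in which all vertices of `F` lie in at most one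
block. -/
def HasSBEPOn (G : SimpleGraph V) (U F : Set V) : Prop :=
  ∃ (H : SimpleGraph V) (𝓑 : Set (Set V)), H ≤ G ∧ BlockSystem H U F 𝓑

lemma HasSBEPOn.mono {G : SimpleGraph V} {U F F' : Set V} (h : HasSBEPOn G U F) (hF : F' ⊆ F) :
    HasSBEPOn G U F' := by
  obtain ⟨H, 𝓑, hle, hB⟩ := h
  exact ⟨H, 𝓑, hle, { hB with one_block := fun v hv => hB.one_block v (hF hv) }⟩

lemma not_isCutvertex_subgraphOfAdj {H : SimpleGraph V} {v w : V} (hw : H.Adj v w) :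
    ∀ x, ¬ IsCutvertex (H.subgraphOfAdj hw).coe x := by
  intro x
  rw [IsCutvertex, not_not]
  rintro ⟨⟨a, ha⟩, ha'⟩ ⟨⟨b, hb⟩, hb'⟩
  obtain ⟨x, hx⟩ := x
  simp only [subgraphOfAdj_verts, Set.mem_insert_iff, Set.mem_singleton_iff] at ha hb hx
  simp only [Set.mem_compl_iff, Set.mem_singleton_iff, Subtype.mk.injEq] at ha' hb'
  have : a = b := by
    rcases ha with rfl | rfl <;> rcases hb with rfl | rfl <;> rcases hx with rfl | rfl <;>
      first | rfl | exact absurd rfl ha' | exact absurd rfl hb'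
  subst this
  exact Reachable.refl _

lemma BlockSystem.isSBEP {H : SimpleGraph V} {F : Set V} {𝓑 : Set (Set V)} [Nontrivial V]
    (h : BlockSystem H Set.univ F 𝓑) : IsSBEP H := by
  have hpre : H.Preconnected := fun x y => h.reachable x trivial y trivial
  have key : ∀ B : H.Subgraph, IsBlock H B → ∃ N ∈ 𝓑, B = (⊤ : H.Subgraph).induce N := by
    intro B hB
    have hnt : B.verts.Nontrivial := by
      by_contra hnt
      rw [Set.not_nontrivial_iff] at hnt
      obtain ⟨⟨v, hv⟩⟩ := hB.1.nonempty
      obtain ⟨w, hw⟩ := hpre.exists_adj_of_nontrivial v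
      have hle : B ≤ H.subgraphOfAdj hw := by
        refine ⟨fun x hx => ?_, fun x y hxy => ?_⟩
        · rw [hnt hx hv]; simp
        · exact absurd (hnt (B.edge_vert hxy) (B.edge_vert hxy.symm)) hxy.ne
      have h2 := hB.2.2 _ hle (Subgraph.subgraphOfAdj_connected hw).coe ?_
      · have : w ∈ B.verts := by rw [← h2]; simp
        exact hw.ne (hnt hv this)
      · exact not_isCutvertex_subgraphOfAdj hw
    obtain ⟨N, hN, hBN⟩ := h.exists_superset _ hnt (.of_coe hB.1.preconnected hB.2.1)
    have hle : B ≤ (⊤ : H.Subgraph).induce N :=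
      ⟨hBN, fun x y hxy => ⟨hBN (B.edge_vert hxy), hBN (B.edge_vert hxy.symm), B.adj_sub hxy⟩⟩
    refine ⟨N, hN, (hB.2.2 _ hle ?_ ?_).symm⟩
    · have : Nonempty N := (h.nonempty N hN).to_subtype
      rw [← induce_eq_coe_induce_top]
      exact { preconnected := (cutConn_iff _ _).1 (h.nonSep N hN).1, nonempty := this }
    · rw [← induce_eq_coe_induce_top]
      exact (h.nonSep N hN).not_isCutvertex
  refine ⟨⟨hpre⟩, fun B hB => ?_, ?_⟩
  · obtain ⟨N, hN, rfl⟩ := key B hB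
    rw [← induce_eq_coe_induce_top]
    exact h.cycle_or_edge N hN
  · rintro v B₁ B₂ B₃ ⟨h1, hv1⟩ ⟨h2, hv2⟩ ⟨h3, hv3⟩
    obtain ⟨N₁, hN₁, rfl⟩ := key B₁ h1
    obtain ⟨N₂, hN₂, rfl⟩ := key B₂ h2
    obtain ⟨N₃, hN₃, rfl⟩ := key B₃ h3
    rcases h.two_blocks v N₁ hN₁ N₂ hN₂ N₃ hN₃ hv1 hv2 hv3 with h | h | h <;> simp [h]

/-- Two SBEP graphs can be glued at a vertex which lies in at most one block of each of them. -/
lemma HasSBEPOn.glue {G : SimpleGraph V} {U₁ F₁ U₂ F₂ : Set V} {v : V}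
    (h₁ : HasSBEPOn G U₁ F₁) (h₂ : HasSBEPOn G U₂ F₂) (hv : U₁ ∩ U₂ = {v})
    (hv₁ : v ∈ F₁) (hv₂ : v ∈ F₂) (hF₁ : F₁ ⊆ U₁) :
    HasSBEPOn G (U₁ ∪ U₂) (F₁ \ {v}) := by
  obtain ⟨H₁, 𝓑₁, hle₁, b₁⟩ := h₁
  obtain ⟨H₂, 𝓑₂, hle₂, b₂⟩ := h₂
  have hvU : v ∈ U₁ ∧ v ∈ U₂ := by
    have : v ∈ U₁ ∩ U₂ := by rw [hv]; rfl
    exact this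
  have huniq : ∀ x, x ∈ U₁ → x ∈ U₂ → x = v := fun x h1 h2 => by
    have : x ∈ U₁ ∩ U₂ := ⟨h1, h2⟩
    rwa [hv] at this
  have e₁ : ∀ x ∈ U₁, ∀ y ∈ U₁, (H₁ ⊔ H₂).Adj x y ↔ H₁.Adj x y := by
    intro x hx y hy
    refine ⟨fun h => h.elim id fun h => ?_, Or.inl⟩
    have := huniq x hx (b₂.adj_mem _ _ h)
    have := huniq y hy (b₂.adj_mem _ _ h.symm)
    exact absurd (by simp_all) h.ne
  have e₂ : ∀ x ∈ U₂, ∀ y ∈ U₂, (H₁ ⊔ H₂).Adj x y ↔ H₂.Adj x y := by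
    intro x hx y hy
    refine ⟨fun h => h.elim (fun h => ?_) id, Or.inr⟩
    have := huniq x (b₁.adj_mem _ _ h) hx
    have := huniq y (b₁.adj_mem _ _ h.symm) hy
    exact absurd (by simp_all) h.ne
  have i₁ : ∀ B ⊆ U₁, (H₁ ⊔ H₂).induce B = H₁.induce B := by
    intro B hB; ext x y; exact e₁ x (hB x.2) y (hB y.2)
  have i₂ : ∀ B ⊆ U₂, (H₁ ⊔ H₂).induce B = H₂.induce B := by
    intro B hB; ext x y; exact e₂ x (hB x.2) y (hB y.2)
  have r : ∀ x ∈ U₁ ∪ U₂, (H₁ ⊔ H₂).Reachable x v := by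
    rintro x (hx | hx)
    · exact (b₁.reachable x hx v hvU.1).mono le_sup_left
    · exact (b₂.reachable x hx v hvU.2).mono le_sup_right
  refine ⟨H₁ ⊔ H₂, 𝓑₁ ∪ 𝓑₂, sup_le hle₁ hle₂, ?_, ?_, ?_, ?_, ?_, ?_, ?_, ?_, ?_⟩
  · rintro x y (h | h)
    · exact .inl (b₁.adj_mem _ _ h)
    · exact .inr (b₂.adj_mem _ _ h)
  · exact fun x hx y hy => (r x hx).trans (r y hy).symm
  · rintro B (hB | hB)
    · exact (b₁.subset B hB).trans Set.subset_union_left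
    · exact (b₂.subset B hB).trans Set.subset_union_right
  · rintro B (hB | hB)
    · exact b₁.nonempty B hB
    · exact b₂.nonempty B hB
  · rintro B (hB | hB)
    · rw [i₁ B (b₁.subset B hB)]; exact b₁.cycle_or_edge B hB
    · rw [i₂ B (b₂.subset B hB)]; exact b₂.cycle_or_edge B hB
  · rintro B (hB | hB)
    · exact (b₁.nonSep B hB).mono fun x _ y _ h => .inl h
    · exact (b₂.nonSep B hB).mono fun x _ y _ h => .inr h
  · intro N hnt hN
    have hNU : N ⊆ U₁ ∪ U₂ := by
      intro x hx
      obtain ⟨y, hy, hyx⟩ := hnt.exists_ne x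
      obtain ⟨a, -, b, -, rfl, -, h | h⟩ := hN.1 {x} ⟨x, hx, rfl⟩ ⟨y, hy, hyx⟩
      · exact .inl (b₁.adj_mem _ _ h)
      · exact .inr (b₂.adj_mem _ _ h)
    by_cases c₁ : N ⊆ U₁
    · obtain ⟨B, hB, h⟩ := b₁.exists_superset N hnt
        (hN.mono fun x hx y hy => (e₁ x (c₁ hx) y (c₁ hy)).1)
      exact ⟨B, .inl hB, h⟩
    by_cases c₂ : N ⊆ U₂
    · obtain ⟨B, hB, h⟩ := b₂.exists_superset N hnt
        (hN.mono fun x hx y hy => (e₂ x (c₂ hx) y (c₂ hy)).1)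
      exact ⟨B, .inr hB, h⟩
    obtain ⟨x, hx, hx₁⟩ := Set.not_subset.1 c₁
    obtain ⟨y, hy, hy₂⟩ := Set.not_subset.1 c₂
    obtain ⟨a, ha, b, hb, haU, hbU, hab⟩ := hN.2 v U₁
      ⟨y, ⟨hy, fun h => hy₂ (h ▸ hvU.2)⟩, (hNU hy).resolve_right hy₂⟩
      ⟨x, ⟨hx, fun h => hx₁ (h ▸ hvU.1)⟩, hx₁⟩
    rcases hab with h | h
    · exact absurd (b₁.adj_mem _ _ h.symm) hbU
    · exact absurd (huniq a haU (b₂.adj_mem _ _ h)) ha.2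
  · intro x B₁ hB₁ B₂ hB₂ B₃ hB₃ h1 h2 h3
    by_cases hxv : x = v
    · subst hxv
      have := b₁.one_block x hv₁
      have := b₂.one_block x hv₂
      grind
    · have s₁ := b₁.subset
      have s₂ := b₂.subset
      have t₁ := b₁.two_blocks x
      have t₂ := b₂.two_blocks x
      have : ¬ (x ∈ U₁ ∧ x ∈ U₂) := fun h => hxv (huniq x h.1 h.2)
      rcases hB₁ with hB₁ | hB₁ <;> rcases hB₂ with hB₂ | hB₂ <;> rcases hB₃ with hB₃ | hB₃ <;>
        first
        | exact t₁ _ hB₁ _ hB₂ _ hB₃ h1 h2 h3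
        | exact t₂ _ hB₁ _ hB₂ _ hB₃ h1 h2 h3
        | exact absurd ⟨s₁ _ hB₁ h1, s₂ _ hB₂ h2⟩ this
        | exact absurd ⟨s₁ _ hB₁ h1, s₂ _ hB₃ h3⟩ this
        | exact absurd ⟨s₁ _ hB₂ h2, s₂ _ hB₁ h1⟩ this
        | exact absurd ⟨s₁ _ hB₂ h2, s₂ _ hB₃ h3⟩ this
        | exact absurd ⟨s₁ _ hB₃ h3, s₂ _ hB₁ h1⟩ this
  · rintro x ⟨hx, hxv⟩ B₁ hB₁ B₂ hB₂ h1 h2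
    have n : x ∉ U₂ := fun h => hxv (huniq x (hF₁ hx) h)
    rcases hB₁ with hB₁ | hB₁
    · rcases hB₂ with hB₂ | hB₂
      · exact b₁.one_block x hx B₁ hB₁ B₂ hB₂ h1 h2
      · exact absurd (b₂.subset _ hB₂ h2) n
    · exact absurd (b₂.subset _ hB₁ h1) n

lemma cycleGraph_adj_add_one {m : ℕ} (i : Fin (m + 2)) : (cycleGraph (m + 2)).Adj i (i + 1) := by
  simp [cycleGraph_adj]

lemma nonSep_map_cycleGraph {m : ℕ} (f : Fin (m + 2) ↪ V) :
    NonSep ((cycleGraph (m + 2)).map f) (Set.range f) := by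
  constructor
  · have := (preconnected_iff_exists_adj_crossing _).1 (cycleGraph_preconnected (n := m + 2))
    rintro D ⟨_, ⟨a, rfl⟩, ha⟩ ⟨_, ⟨b, rfl⟩, hb⟩
    obtain ⟨x, y, hx, hy, hxy⟩ := this (f ⁻¹' D) ⟨a, ha⟩ ⟨b, hb⟩
    exact ⟨f x, ⟨x, rfl⟩, f y, ⟨y, rfl⟩, hx, hy, (Embedding.map f _).map_adj_iff.2 hxy⟩
  · intro w
    by_cases hw : w ∈ Set.range f
    swap
    · rw [Set.sdiff_singleton_eq_self hw]
      have := (preconnected_iff_exists_adj_crossing _).1 (cycleGraph_preconnected (n := m + 2))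
      rintro D ⟨_, ⟨a, rfl⟩, ha⟩ ⟨_, ⟨b, rfl⟩, hb⟩
      obtain ⟨x, y, hx, hy, hxy⟩ := this (f ⁻¹' D) ⟨a, ha⟩ ⟨b, hb⟩
      exact ⟨f x, ⟨x, rfl⟩, f y, ⟨y, rfl⟩, hx, hy, (Embedding.map f _).map_adj_iff.2 hxy⟩
    obtain ⟨c, rfl⟩ := hw
    rintro D ⟨_, ⟨⟨a, rfl⟩, ha'⟩, ha⟩ ⟨_, ⟨⟨b, rfl⟩, hb'⟩, hb⟩
    by_contra hcon
    have step : ∀ i : Fin (m + 2), i ≠ c → i + 1 ≠ c → (f (i + 1) ∈ D ↔ f i ∈ D) := by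
      intro i h1 h2
      have m1 : f i ∈ Set.range f \ {f c} := ⟨⟨i, rfl⟩, fun h => h1 (f.injective h)⟩
      have m2 : f (i + 1) ∈ Set.range f \ {f c} := ⟨⟨_, rfl⟩, fun h => h2 (f.injective h)⟩
      have hadj : ((cycleGraph (m + 2)).map f).Adj (f i) (f (i + 1)) :=
        (Embedding.map f _).map_adj_iff.2 (cycleGraph_adj_add_one i)
      constructor
      · intro h; by_contra h'
        exact hcon ⟨_, m2, _, m1, h, h', hadj.symm⟩
      · intro h; by_contra h'
        exact hcon ⟨_, m1, _, m2, h, h', hadj⟩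
    have hsucc : ∀ j : ℕ, Fin.ofNat (m + 2) (j + 1) = Fin.ofNat (m + 2) j + 1 := by
      intro j; ext; simp [Fin.val_add]
    have hne : ∀ j : ℕ, j + 1 < m + 2 → c + 1 + Fin.ofNat (m + 2) j ≠ c := by
      intro j hj h
      have h2 : Fin.ofNat (m + 2) (j + 1) = 0 := by
        rw [hsucc]
        have : c + (Fin.ofNat (m + 2) j + 1) = c + 0 := by 
          rw [add_zero]; nth_rw 2 [← h]; abel
        exact add_left_cancel this
      have := congrArg Fin.val h2
      rw [Fin.val_ofNat, Nat.mod_eq_of_lt hj] at this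
      simp at this
    have all : ∀ j : ℕ, j + 1 < m + 2 → (f (c + 1 + Fin.ofNat (m + 2) j) ∈ D ↔ f (c + 1) ∈ D) := by
      intro j
      induction j with
      | zero => simp
      | succ j ih =>
        intro hj
        rw [← ih (by omega)]
        have e : c + 1 + Fin.ofNat (m + 2) (j + 1) = c + 1 + Fin.ofNat (m + 2) j + 1 := by
          rw [hsucc]; abel
        have := step (c + 1 + Fin.ofNat (m + 2) j) (hne j (by omega)) (e ▸ hne (j + 1) hj)
        rwa [e]
    have rep : ∀ a : Fin (m + 2), f a ∉ ({f c} : Set V) → (f a ∈ D ↔ f (c + 1) ∈ D) := by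
      intro a ha
      have hlt : (a - c - 1).val + 1 < m + 2 := by
        by_contra hge
        have h1 : (a - c - 1).val = m + 1 := by have := (a - c - 1).isLt; omega
        have h2 : a - c - 1 = Fin.last (m + 1) := Fin.ext h1
        have h3 : a - c - 1 + 1 = 0 := by rw [h2]; simp
        have h4 : a = c := by
          have : a - c = 0 := by simpa using h3
          exact sub_eq_zero.1 this
        exact ha (by rw [h4]; rfl)
      have := all _ hlt
      rwa [Fin.ofNat_val_eq_self, show c + 1 + (a - c - 1) = a by abel] at this
    exact hb ((rep b hb').2 ((rep a ha').1 ha))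

lemma isSingleEdgeGraph_of_iso {H : SimpleGraph W} (e : cycleGraph 2 ≃g H) :
    IsSingleEdgeGraph H := by
  refine ⟨e 0, e 1, fun h => by simpa using e.injective h,
    e.map_adj_iff.2 (by simp [cycleGraph_two_eq_top]), fun w => ?_⟩
  obtain ⟨i, rfl⟩ := e.surjective w
  fin_cases i <;> simp

/-- Even cycles and single edges of `G` are SBEP graphs with a single block. -/
lemma hasSBEPOn_range {G : SimpleGraph V} {m : ℕ} (hm : Even m) (f : Fin (m + 2) ↪ V)
    (h : ∀ i, G.Adj (f i) (f (i + 1))) : HasSBEPOn G (Set.range f) (Set.range f) := by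
  have hmem : ∀ x y, ((cycleGraph (m + 2)).map f).Adj x y → x ∈ Set.range f := by
    rintro x y ⟨-, a, b, -, rfl, -⟩
    exact ⟨a, rfl⟩
  refine ⟨(cycleGraph (m + 2)).map f, {Set.range f}, ?_, hmem, ?_, ?_, ?_, ?_, ?_, ?_, ?_, ?_⟩
  · rintro _ _ ⟨-, a, b, hab, rfl, rfl⟩
    rcases cycleGraph_adj.1 hab with h' | h'
    · rw [show a = b + 1 by rw [← h']; abel]
      exact (h b).symm
    · rw [show b = a + 1 by rw [← h']; abel]
      exact h a
  · rintro _ ⟨a, rfl⟩ _ ⟨b, rfl⟩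
    exact (cycleGraph_preconnected a b).map (Embedding.map f (cycleGraph (m + 2))).toHom
  · rintro B rfl; exact subset_rfl
  · rintro B rfl; exact ⟨f 0, 0, rfl⟩
  · rintro B rfl
    have e : cycleGraph (m + 2) ≃g ((cycleGraph (m + 2)).map f).induce (Set.range f) :=
      (Embedding.map f (cycleGraph (m + 2))).isoInduceRange
    rcases Nat.eq_zero_or_pos m with rfl | hpos
    · exact .inr (isSingleEdgeGraph_of_iso e)
    · exact .inl ⟨m + 2, by simpa [Nat.even_add] using hm, by omega, ⟨e.symm⟩⟩
  · rintro B rfl; exact nonSep_map_cycleGraph f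
  · intro N hnt hN
    refine ⟨_, rfl, fun x hx => ?_⟩
    obtain ⟨y, hy, hyx⟩ := hnt.exists_ne x
    obtain ⟨a, -, b, -, rfl, -, h⟩ := hN.1 {x} ⟨x, hx, rfl⟩ ⟨y, hy, hyx⟩
    exact hmem _ _ h
  · rintro v _ rfl _ rfl _ rfl _ _ _; exact .inl rfl
  · rintro v _ _ rfl _ rfl _ _; rfl

lemma hasSBEPOn_cons {G : SimpleGraph V} {l : List V} {r x y : V} (hodd : Odd l.length)
    (hnd : l.Nodup) (hch : l.IsChain G.Adj) (hx : l.head? = some x) (hy : l.getLast? = some y)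
    (hr : r ∉ l) (hrx : G.Adj r x) (hry : G.Adj r y) :
    HasSBEPOn G {z | z ∈ r :: l} {z | z ∈ r :: l} := by
  obtain ⟨m, hm⟩ : ∃ m, l.length = m + 1 := ⟨l.length - 1, by have := hodd.pos; omega⟩
  have hlen : (r :: l).length = m + 2 := by simp [hm]
  have hnd' : (r :: l).Nodup := List.nodup_cons.2 ⟨hr, hnd⟩
  have hch' : (r :: l).IsChain G.Adj := by
    rw [List.isChain_cons]
    exact ⟨fun z hz => by rw [hx] at hz; cases hz; exact hrx, hch⟩
  let f : Fin (m + 2) ↪ V :=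
    ⟨fun i => (r :: l)[i.val]'(by rw [hlen]; exact i.isLt), fun i j hij => by
      exact Fin.ext ((List.Nodup.getElem_inj_iff hnd').1 hij)⟩
  have hrange : Set.range f = {z | z ∈ r :: l} := by
    ext z
    constructor
    · rintro ⟨i, rfl⟩; exact List.getElem_mem _
    · intro hz
      obtain ⟨i, hi, rfl⟩ := List.getElem_of_mem hz
      exact ⟨⟨i, by omega⟩, rfl⟩
  have hf : ∀ i, f i = (r :: l)[i.val]'(by rw [hlen]; exact i.isLt) := fun _ => rfl
  rw [← hrange]
  refine hasSBEPOn_range ?_ f fun i => ?_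
  · rw [hm] at hodd
    by_contra h
    exact (Nat.not_even_iff_odd.2 hodd) (Odd.add_one (Nat.not_even_iff_odd.1 h))
  · by_cases hi : i = Fin.last (m + 1)
    · subst hi
      have e1 : f (Fin.last (m + 1) + 1) = r := by simp [hf]
      have e2 : f (Fin.last (m + 1)) = y := by
        have h1 : l.getLast? = some (l[m]'(by omega)) := by
          rw [List.getLast?_eq_getElem?]; simp [hm]
        have : l[m]'(by omega) = y := by rw [hy] at h1; exact (Option.some.inj h1).symm
        simpa [hf] using this
      rw [e1, e2]; exact hry.symm
    · have hv : (i + 1).val = i.val + 1 := Fin.val_add_one_of_lt (Fin.lt_last_iff_ne_last.2 hi)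
      have hlt : i.val + 1 < (r :: l).length := by
        have := (i + 1).isLt; omega
      have := List.isChain_iff_getElem.1 hch' i.val hlt
      change G.Adj _ ((r :: l)[(i + 1).val]'_)
      simp only [hv]
      exact this

/-- `HungPath G U x y n` says that `U` is the vertex set of a path in `G` with `n` vertices and
ends `x`, `y`, together with even cycles and edges that are hung recursively at its vertices, each
vertex being used for at most one cycle or edge besides the structure it was first placed on. -/
inductive HungPath [DecidableEq V] (G : SimpleGraph V) : Finset V → V → V → ℕ → Prop
  | single (r : V) : HungPath G {r} r r 1
  | close {U : Finset V} {x y : V} {n : ℕ} (r : V) (h : HungPath G U x y n) (hn : Odd n)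
      (hr : r ∉ U) (hrx : G.Adj r x) (hry : G.Adj r y) : HungPath G (insert r U) r r 1
  | cons {U U' : Finset V} {r x y : V} {n : ℕ} (h : HungPath G U r r 1)
      (h' : HungPath G U' x y n) (hd : Disjoint U U') (hrx : G.Adj r x) :
      HungPath G (U ∪ U') r y (n + 1)

namespace HungPath

variable [DecidableEq V] {G : SimpleGraph V} {U U' : Finset V} {x y x' y' r : V} {n m : ℕ}

lemma pos (h : HungPath G U x y n) : 0 < n := by cases h <;> omega

lemma left_mem (h : HungPath G U x y n) : x ∈ U := by
  induction h with
  | single r => simp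
  | close r h => simp
  | cons h h' hd hrx ih ih' => exact Finset.mem_union_left _ ih

lemma right_mem (h : HungPath G U x y n) : y ∈ U := by
  induction h with
  | single r => simp
  | close r h => simp
  | cons h h' hd hrx ih ih' => exact Finset.mem_union_right _ ih'

lemma append (h : HungPath G U x y n) (h' : HungPath G U' x' y' m) (hd : Disjoint U U')
    (hyx : G.Adj y x') : HungPath G (U ∪ U') x y' (n + m) := by
  induction h with
  | single r => rw [add_comm]; exact cons (single r) h' hd hyx
  | close r h hn hr hrx hry => rw [add_comm]; exact cons (close r h hn hr hrx hry) h' hd hyx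
  | cons h h₂ hd' hrx ih ih' =>
    rw [Finset.disjoint_union_left] at hd
    rw [Finset.union_assoc, add_right_comm]
    exact cons h (ih' hd.2 hyx) (Finset.disjoint_union_right.2 ⟨hd', hd.1⟩) hrx

lemma exists_list (h : HungPath G U x y n) : ∃ l : List V, l.length = n ∧ l.Nodup ∧
    (∀ z ∈ l, z ∈ U) ∧ l.IsChain G.Adj ∧ l.head? = some x ∧ l.getLast? = some y ∧
    ∀ W F : Set V, HasSBEPOn G W F → F ⊆ W → W ∩ U = {z | z ∈ l} → {z | z ∈ l} ⊆ F →
      HasSBEPOn G (W ∪ U) (F \ {z | z ∈ l}) := by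
  induction h with
  | single r =>
    refine ⟨[r], by simp, by simp, by simp, by simp, by simp, by simp, ?_⟩
    intro W F h hF hW hl
    have : W ∪ ↑({r} : Finset V) = W := by
      have : r ∈ W := hF (hl (by simp))
      simpa using this
    rw [this]
    exact h.mono Set.sdiff_subset
  | @close U x y n r h hn hr hrx hry ih =>
    obtain ⟨l, h1, h2, h3, h4, h5, h6, h7⟩ := ih
    refine ⟨[r], by simp, by simp, by simp, by simp, by simp, by simp, ?_⟩
    intro W F h hF hW hl
    have hrl : r ∉ l := fun h => hr (h3 _ h)
    have c := hasSBEPOn_cons (h1 ▸ hn) h2 h4 h5 h6 hrl hrx hry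
    have c' := h7 _ _ c subset_rfl (by
      ext z
      simp only [List.mem_cons, Set.mem_inter_iff, Set.mem_ofPred_eq, Finset.mem_coe]
      constructor
      · rintro ⟨rfl | h, h'⟩
        · exact absurd h' hr
        · exact h
      · exact fun h => ⟨Or.inr h, h3 _ h⟩) (fun z hz => List.mem_cons_of_mem _ hz)
    have hrF : r ∈ F := hl (by simp)
    have hW' : ∀ z ∈ W, z = r ∨ z ∈ U → z = r := fun z hz hz' => by
      have : z ∈ W ∩ ↑(insert r U) := ⟨hz, by simpa using hz'⟩
      rw [hW] at this
      simpa using this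
    have := h.glue (v := r) c' (by
      ext z
      simp only [List.mem_cons, Set.mem_inter_iff, Set.mem_union, Set.mem_ofPred_eq,
        Finset.mem_coe, Set.mem_singleton_iff]
      constructor
      · rintro ⟨hz, (h | h) | h⟩
        · exact h
        · exact hW' z hz (Or.inr (h3 _ h))
        · exact hW' z hz (Or.inr h)
      · rintro rfl
        exact ⟨hF hrF, Or.inl (Or.inl rfl)⟩) hrF ⟨by simp, hrl⟩ hF
    convert this using 1
    · ext z
      have := h3 z
      simp only [Finset.coe_insert, Set.mem_union, Set.mem_insert_iff, Finset.mem_coe,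
        List.mem_cons, Set.mem_ofPred_eq]
      tauto
    · ext z
      simp
  | @cons U U' r x y n h h' hd hrx ih ih' =>
    obtain ⟨l, h1, h2, h3, h4, h5, h6, h7⟩ := ih
    obtain ⟨a, rfl⟩ := List.length_eq_one_iff.1 h1
    obtain rfl : a = r := by simpa using h5
    obtain ⟨l', g1, g2, g3, g4, g5, g6, g7⟩ := ih'
    have ha : a ∈ U := h3 a (by simp)
    have hdis : ∀ z ∈ U, z ∉ U' := fun z hz hz' => Finset.disjoint_left.1 hd hz hz'
    have hal : a ∉ l' := fun h => hdis _ ha (g3 _ h)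
    refine ⟨a :: l', by simp [g1], List.nodup_cons.2 ⟨hal, g2⟩, ?_, ?_, by simp, ?_, ?_⟩
    · intro z hz
      rcases List.mem_cons.1 hz with rfl | hz
      · exact Finset.mem_union_left _ ha
      · exact Finset.mem_union_right _ (g3 _ hz)
    · rw [List.isChain_cons]
      exact ⟨fun z hz => by rw [g5] at hz; simp at hz; exact hz ▸ hrx, g4⟩
    · simp [List.getLast?_cons, g6]
    · intro W F hW hF hWU hl
      have hmem : ∀ z, z ∈ W → z ∈ U ∨ z ∈ U' → z = a ∨ z ∈ l' := fun z hz hz' => by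
        have : z ∈ W ∩ ↑(U ∪ U') := ⟨hz, by simpa using hz'⟩
        rw [hWU] at this
        simpa using this
      have haF : a ∈ F := hl (by simp)
      have hlF : ∀ z ∈ l', z ∈ F := fun z hz => hl (by simp [hz])
      have c := h7 W F hW hF (by
        ext z
        simp only [Set.mem_inter_iff, Finset.mem_coe, List.mem_singleton, Set.mem_ofPred_eq]
        constructor
        · rintro ⟨hz, hzU⟩
          exact (hmem z hz (Or.inl hzU)).resolve_right fun h => hdis z hzU (g3 z h)
        · rintro rfl
          exact ⟨hF haF, ha⟩) (by simpa using haF)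
      have c' := g7 _ _ c (Set.sdiff_subset.trans (hF.trans Set.subset_union_left)) (by
        ext z
        simp only [Set.mem_inter_iff, Set.mem_union, Finset.mem_coe, Set.mem_ofPred_eq]
        constructor
        · rintro ⟨hz | hz, hzU⟩
          · refine (hmem z hz (Or.inr hzU)).resolve_left ?_
            rintro rfl
            exact hdis _ ha hzU
          · exact absurd hzU (hdis _ hz)
        · exact fun hz => ⟨Or.inl (hF (hlF z hz)), g3 z hz⟩) (fun z hz => ⟨hlF z hz, by
          simp only [List.mem_singleton, Set.mem_ofPred_eq]
          rintro rfl
          exact hal hz⟩)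
      convert c' using 1
      · rw [Finset.coe_union, Set.union_assoc]
      · ext z
        simp only [List.mem_cons, Set.mem_sdiff, Set.mem_ofPred_eq]
        tauto

lemma hasSBEPOn (h : HungPath G U x y n) (hn : Odd n) (hr : r ∉ U) (hrx : G.Adj r x)
    (hry : G.Adj r y) : HasSBEPOn G (insert r ↑U) {r} := by
  obtain ⟨l, h1, h2, h3, h4, h5, h6, h7⟩ := h.exists_list
  have hrl : r ∉ l := fun h => hr (h3 _ h)
  have c := h7 _ _ (hasSBEPOn_cons (h1 ▸ hn) h2 h4 h5 h6 hrl hrx hry) subset_rfl (by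
    ext z
    simp only [List.mem_cons, Set.mem_inter_iff, Set.mem_ofPred_eq, Finset.mem_coe]
    constructor
    · rintro ⟨rfl | h, h'⟩
      · exact absurd h' hr
      · exact h
    · exact fun h => ⟨Or.inr h, h3 _ h⟩) (fun z hz => List.mem_cons_of_mem _ hz)
  have e : {z | z ∈ r :: l} ∪ (U : Set V) = insert r ↑U := by
    ext z
    have := h3 z
    simp only [List.mem_cons, Set.mem_union, Set.mem_ofPred_eq, Finset.mem_coe, Set.mem_insert_iff]
    tauto
  rw [e] at c
  refine c.mono ?_
  rintro z rfl
  exact ⟨by simp, hrl⟩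

/-- The root of a one-vertex path either carries nothing, or can be separated from the path
hung at it. -/
lemma eq_singleton_or (h : HungPath G U r r 1) : U = {r} ∨ ∃ (U₀ : Finset V) (x y : V) (n : ℕ),
    HungPath G U₀ x y n ∧ Odd n ∧ r ∉ U₀ ∧ U = insert r U₀ := by
  cases h with
  | single => exact Or.inl rfl
  | close _ h hn hr => exact Or.inr ⟨_, _, _, _, h, hn, hr, rfl⟩
  | cons h h' => exact absurd h'.pos (by omega)

lemma exists_split (h : HungPath G U x y n) (hn : Odd n) (hU : 1 < U.card) :
    ∃ (U₁ U₂ : Finset V) (x₁ y₁ x₂ y₂ : V) (n₁ n₂ : ℕ), HungPath G U₁ x₁ y₁ n₁ ∧ Odd n₁ ∧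
      HungPath G U₂ x₂ y₂ n₂ ∧ Odd n₂ ∧ Disjoint U₁ U₂ ∧ U₁ ∪ U₂ = U := by
  cases h with
  | single => simp at hU
  | close r h hn' hr =>
    exact ⟨{x}, _, _, _, _, _, _, _, single x, odd_one, h, hn', by simpa using hr, by simp⟩
  | @cons A B _ z _ n h h' hd hrx =>
    rcases h.eq_singleton_or with rfl | ⟨U₀, a, b, k, h₀, hk, hx, rfl⟩
    swap
    · rw [Finset.disjoint_insert_left] at hd
      refine ⟨_, _, _, _, _, _, _, _, h₀, hk, cons (single x) h' (by simpa using hd.1) hrx, hn,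
        by simp [hx, hd.2], ?_⟩
      ext; simp
    cases h' with
    | single => exact absurd hn (by decide)
    | close => exact absurd hn (by decide)
    | @cons C D _ w _ n h₂ h₃ hd₂ hrx₂ =>
      have hn' : Odd n := by
        rcases hn with ⟨k, hk⟩
        have := h₃.pos
        exact ⟨k - 1, by omega⟩
      rcases h₂.eq_singleton_or with rfl | ⟨U₀, a, b, k, h₀, hk, hx, rfl⟩
      · refine ⟨_, _, _, _, _, _, _, _, close x (single z) odd_one ?_ hrx hrx, odd_one, h₃, hn',
          ?_, ?_⟩
        · simpa using hrx.ne
        · simp only [Finset.disjoint_singleton_left, Finset.mem_union] at hd hd₂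
          simp only [Finset.disjoint_insert_left, Finset.disjoint_singleton_left]
          tauto
        · ext; simp; tauto
      · simp only [Finset.disjoint_insert_left, Finset.disjoint_singleton_left, Finset.mem_union,
          Finset.mem_insert] at hd hd₂
        refine ⟨_, _, _, _, _, _, _, _, h₀, hk,
          cons (single x) (cons (single z) h₃ ?_ hrx₂) ?_ hrx, hn, ?_, ?_⟩
        · simpa using hd₂.1
        · simp; tauto
        · simp only [Finset.disjoint_union_right, Finset.disjoint_singleton_right]
          tauto
        · ext; simp

end HungPath

/-- `PathCover G E X k` says that `X` can be partitioned into `k` sets, each carrying a hung path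
with an odd number of vertices and both ends in `E`. -/
inductive PathCover [DecidableEq V] (G : SimpleGraph V) (E : Set V) : Finset V → ℕ → Prop
  | nil : PathCover G E ∅ 0
  | cons {U X : Finset V} {x y : V} {n k : ℕ} (h : HungPath G U x y n) (hn : Odd n) (hx : x ∈ E)
      (hy : y ∈ E) (hX : PathCover G E X k) (hd : Disjoint U X) : PathCover G E (U ∪ X) (k + 1)

namespace PathCover

variable [DecidableEq V] {G : SimpleGraph V} {E E' : Set V} {A X Y : Finset V} {a : V} {k m : ℕ}

lemma mono (h : PathCover G E X k) (hE : E ⊆ E') : PathCover G E' X k := by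
  induction h with
  | nil => exact nil
  | cons h hn hx hy hX hd ih => exact cons h hn (hE hx) (hE hy) ih hd

lemma of_subset (h : PathCover G E X k) (hE : (X : Set V) ⊆ E') : PathCover G E' X k := by
  induction h with
  | nil => exact nil
  | cons h hn hx hy hX hd ih =>
    rw [Finset.coe_union, Set.union_subset_iff] at hE
    exact cons h hn (hE.1 h.left_mem) (hE.1 h.right_mem) (ih hE.2) hd

lemma union (h : PathCover G E X k) (h' : PathCover G E Y m) (hd : Disjoint X Y) :
    PathCover G E (X ∪ Y) (k + m) := by
  induction h with
  | nil => simpa using h'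
  | cons h hn hx hy hX hd' ih =>
    rw [Finset.disjoint_union_left] at hd
    rw [Finset.union_assoc, add_right_comm]
    exact cons h hn hx hy (ih hd.2) (Finset.disjoint_union_right.2 ⟨hd', hd.1⟩)

lemma singleton (a : V) : PathCover G Set.univ {a} 1 := by
  simpa using cons (G := G) (.single a) odd_one (Set.mem_univ a) (Set.mem_univ a) nil
    (Finset.disjoint_empty_right _)

lemma succ (h : PathCover G Set.univ X k) (hk : k < X.card) : PathCover G Set.univ X (k + 1) := by
  induction h with
  | nil => simp at hk
  | @cons U X x y n k h hn hx hy hX hd ih =>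
    by_cases hU : 1 < U.card
    · obtain ⟨U₁, U₂, x₁, y₁, x₂, y₂, n₁, n₂, h₁, hn₁, h₂, hn₂, hd', rfl⟩ := h.exists_split hn hU
      rw [Finset.disjoint_union_left] at hd
      rw [Finset.union_assoc]
      exact cons h₁ hn₁ trivial trivial (cons h₂ hn₂ trivial trivial hX hd.2)
        (Finset.disjoint_union_right.2 ⟨hd', hd.1⟩)
    · rw [Finset.card_union_of_disjoint hd] at hk
      exact cons h hn hx hy (ih (by omega)) hd

lemma of_le (h : PathCover G Set.univ X k) (hk : k ≤ m) (hm : m ≤ X.card) :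
    PathCover G Set.univ X m := by
  induction m, hk using Nat.le_induction with
  | base => exact h
  | succ m hkm ih => exact (ih (by omega)).succ (by omega)

lemma insert_two (h : PathCover G E X (k + 2)) (ha : a ∉ X) (hE : ∀ e ∈ E, G.Adj a e) :
    PathCover G E (insert a X) (k + 1) := by
  cases h with
  | @cons U₁ _ x₁ y₁ n₁ _ h₁ hn₁ hx₁ hy₁ h hd₁ =>
  cases h with
  | @cons U₂ X x₂ y₂ n₂ _ h₂ hn₂ hx₂ hy₂ hX hd₂ =>
  simp only [Finset.mem_union, not_or, Finset.disjoint_union_right] at ha hd₁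
  have h₃ := h₁.append ((HungPath.single a).append h₂ (by simpa using ha.2.1) (hE _ hx₂))
    (by simp [hd₁, ha]) (hE _ hy₁).symm
  have := cons h₃ (by rw [add_left_comm, add_comm]; exact (hn₁.add_odd hn₂).add_one) hx₁ hy₂ hX
    (by simp [hd₁, hd₂, ha])
  convert this using 1
  ext; simp

lemma insert_three (h : PathCover G E X (k + 3)) (ha : a ∉ X) (hE : ∀ e ∈ E, G.Adj a e) :
    PathCover G E (insert a X) (k + 1) := by
  cases h with
  | @cons U₁ _ x₁ y₁ n₁ _ h₁ hn₁ hx₁ hy₁ h hd₁ =>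
  cases h with
  | @cons U₂ _ x₂ y₂ n₂ _ h₂ hn₂ hx₂ hy₂ h hd₂ =>
  cases h with
  | @cons U₃ X x₃ y₃ n₃ _ h₃ hn₃ hx₃ hy₃ hX hd₃ =>
  simp only [Finset.mem_union, not_or, Finset.disjoint_union_right] at ha hd₁ hd₂
  have h₄ := h₁.append ((HungPath.close a h₃ hn₃ ha.2.2.1 (hE _ hx₃) (hE _ hy₃)).append h₂
    (by simp [ha, hd₂.1.symm]) (hE _ hx₂)) (by simp [hd₁, ha]) (hE _ hy₁).symm
  have := cons h₄ (by rw [add_left_comm, add_comm]; exact (hn₁.add_odd hn₂).add_one) hx₁ hy₂ hX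
    (by simp [hd₁, hd₂, hd₃, ha])
  convert this using 1
  ext; simp; tauto

lemma insert_one (h : PathCover G E X (k + 1)) (ha : a ∉ X) (hE : ∀ e ∈ E, G.Adj a e) :
    PathCover G Set.univ (insert a X) (k + 1) := by
  cases h with
  | @cons U X x y n _ h hn hx hy hX hd =>
  simp only [Finset.mem_union, not_or] at ha
  rw [← Finset.insert_union]
  exact cons (.close a h hn ha.1 (hE _ hx) (hE _ hy)) odd_one trivial trivial
    (hX.mono (Set.subset_univ _)) (by simp [hd, ha])

lemma union_of_forall_adj (h : PathCover G E Y (k + m)) (hd : Disjoint A Y)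
    (hE : ∀ a ∈ A, ∀ e ∈ E, G.Adj a e) (hk : 0 < k) (hm : A.card ≤ m) (hm' : m ≤ 2 * A.card) :
    PathCover G E (A ∪ Y) k := by
  induction A using Finset.induction_on generalizing k m with
  | empty =>
    obtain rfl : m = 0 := by simpa using hm'
    simpa using h
  | insert a A ha ih =>
    rw [Finset.disjoint_insert_left] at hd
    rw [Finset.card_insert_of_notMem ha] at hm hm'
    have haY : a ∉ A ∪ Y := by simp [ha, hd.1]
    have hE' : ∀ b ∈ A, ∀ e ∈ E, G.Adj b e := fun b hb => hE b (Finset.mem_insert_of_mem hb)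
    obtain ⟨k, rfl⟩ : ∃ k', k = k' + 1 := ⟨k - 1, by omega⟩
    rw [Finset.insert_union]
    by_cases hm₁ : m ≤ 2 * A.card + 1
    · obtain ⟨m, rfl⟩ : ∃ m', m = m' + 1 := ⟨m - 1, by omega⟩
      refine (ih (k := k + 2) (m := m) ?_ hd.2 hE' (by omega) (by omega) (by omega)).insert_two
        haY (hE a (Finset.mem_insert_self _ _))
      rwa [show k + 2 + m = k + 1 + (m + 1) by omega]
    · obtain ⟨m, rfl⟩ : ∃ m', m = m' + 2 := ⟨m - 2, by omega⟩
      refine (ih (k := k + 3) (m := m) ?_ hd.2 hE' (by omega) (by omega) (by omega)).insert_three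
        haY (hE a (Finset.mem_insert_self _ _))
      rwa [show k + 3 + m = k + 1 + (m + 2) by omega]

end PathCover

/-- No four vertices of `G` induce a path, in the given order. -/
def NoInducedPath (G : SimpleGraph V) : Prop := ∀ a b c d, G.Adj a b → G.Adj b c → G.Adj c d →
  ¬ G.Adj a c → ¬ G.Adj a d → G.Adj b d

lemma P4Free.noInducedPath {G : SimpleGraph V} (h : P4Free G) : NoInducedPath G := by
  intro a b c d hab hbc hcd hac had
  by_contra hbd
  have h₁ := hab.ne
  have h₂ := hbc.ne
  have h₃ := hcd.ne
  have h₄ : a ≠ c := fun h => had (h ▸ hcd)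
  have h₅ : a ≠ d := fun h => hac (h ▸ hcd.symm)
  have h₆ : b ≠ d := fun h => had (h ▸ hab)
  refine h.false ⟨⟨![a, b, c, d], ?_⟩, ?_⟩
  · intro i j hij
    fin_cases i <;> fin_cases j <;> simp_all
  · intro i j
    change G.Adj (![a, b, c, d] i) (![a, b, c, d] j) ↔ _
    fin_cases i <;> fin_cases j <;> simp_all [pathGraph_adj, G.adj_comm]

lemma NoInducedPath.compl {G : SimpleGraph V} (h : NoInducedPath G) : NoInducedPath Gᶜ := by
  intro a b c d hab hbc hcd hac had
  have h₄ : a ≠ c := fun h => had (h ▸ hcd)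
  have h₅ : a ≠ d := fun h => hac (h ▸ hcd.symm)
  have h₆ : b ≠ d := fun h => had (h ▸ hab)
  simp only [compl_adj, not_and, not_not] at *
  refine ⟨h₆, fun hbd => ?_⟩
  exact hab.2 (h c a d b (hac h₄).symm (had h₅) hbd.symm hcd.2 (fun h => hbc.2 h.symm))

section

variable {G : SimpleGraph V} {X A B : Finset V} {v : V}

/-- `X` splits into two nonempty parts with no edges of `G` between them. -/
def NoEdgeSplit [DecidableEq V] (G : SimpleGraph V) (X : Finset V) : Prop :=
  ∃ A B : Finset V, A.Nonempty ∧ B.Nonempty ∧ Disjoint A B ∧ A ∪ B = X ∧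
    ∀ a ∈ A, ∀ b ∈ B, ¬ G.Adj a b

lemma NoInducedPath.split_insert [DecidableEq V] (h : NoInducedPath G) (hX : NoEdgeSplit G X)
    (hv : v ∉ X) : NoEdgeSplit G (insert v X) ∨ NoEdgeSplit Gᶜ (insert v X) := by
  classical
  obtain ⟨A, B, hA, hB, hd, rfl, hAB⟩ := hX
  by_cases hall : ∀ y ∈ A ∪ B, G.Adj v y
  · refine Or.inr ⟨{v}, A ∪ B, by simp, hA.mono Finset.subset_union_left, by simpa using hv, ?_, ?_⟩
    · ext; simp
    · intro a ha b hb
      rw [Finset.mem_singleton.1 ha]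
      simp [hall b hb]
  push Not at hall
  obtain ⟨y, hy, hvy⟩ := hall
  wlog hyA : y ∈ A generalizing A B
  · rw [Finset.union_comm] at hv hy ⊢
    exact this B A hB hA hd.symm (fun a ha b hb hab => hAB b hb a ha hab.symm) hv hy
      ((Finset.mem_union.1 hy).resolve_right hyA)
  set r : V → V → Prop := fun u w => G.Adj u w ∧ w ∈ A with hr
  set C := A.filter fun z => Relation.ReflTransGen r y z with hC
  have hyC : y ∈ C := by simp [hC, hyA, Relation.ReflTransGen.refl]
  have hclosed : ∀ u ∈ C, ∀ w ∈ A ∪ B, G.Adj u w → w ∈ C := by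
    intro u hu w hw huw
    rw [hC, Finset.mem_filter] at hu ⊢
    have hwA : w ∈ A := (Finset.mem_union.1 hw).resolve_right fun hwB => hAB u hu.1 w hwB huw
    exact ⟨hwA, hu.2.tail ⟨huw, hwA⟩⟩
  have hCA : C ⊆ A := Finset.filter_subset _ _
  by_cases hvC : ∃ x ∈ C, G.Adj v x
  · obtain ⟨x, hx, hvx⟩ := hvC
    have hcross : ∀ z, Relation.ReflTransGen r y z → G.Adj v z →
        ∃ u ∈ C, ∃ w ∈ C, G.Adj u w ∧ ¬ G.Adj v u ∧ G.Adj v w := by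
      intro z hz
      induction hz with
      | refl => exact fun h => absurd h hvy
      | @tail b c hb hbc ih =>
        intro hvc
        by_cases hvb : G.Adj v b
        · exact ih hvb
        · have hbA : b ∈ A := by
            rcases hb.cases_tail with rfl | ⟨_, -, h⟩
            · exact hyA
            · exact h.2
          exact ⟨b, by simp [hC, hbA, hb], c, by simp [hC, hbc.2, hb.tail hbc], hbc.1, hvb, hvc⟩
    obtain ⟨u, hu, w, hw, huw, hvu, hvw⟩ := hcross x (Finset.mem_filter.1 hx).2 hvx
    left
    refine ⟨insert v C, (A ∪ B) \ C, by simp, ?_, ?_, ?_, ?_⟩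
    · obtain ⟨b, hb⟩ := hB
      exact ⟨b, Finset.mem_sdiff.2 ⟨Finset.mem_union_right _ hb,
        fun h => Finset.disjoint_left.1 hd (hCA h) hb⟩⟩
    · simp only [Finset.disjoint_insert_left, Finset.mem_sdiff, hv, false_and, not_false_eq_true,
        true_and]
      exact Finset.disjoint_sdiff
    · rw [Finset.insert_union, Finset.union_sdiff_of_subset (hCA.trans Finset.subset_union_left)]
    · intro a ha b hb hab
      rw [Finset.mem_sdiff] at hb
      rcases Finset.mem_insert.1 ha with rfl | ha
      · exact hvu (h b a w u hab.symm hvw huw.symm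
          (fun h' => hb.2 (hclosed w hw b hb.1 h'.symm))
          (fun h' => hb.2 (hclosed u hu b hb.1 h'.symm)))
      · exact hb.2 (hclosed a ha b hb.1 hab)
  · push Not at hvC
    left
    refine ⟨C, insert v ((A ∪ B) \ C), ⟨y, hyC⟩, by simp, ?_, ?_, ?_⟩
    · simp only [Finset.disjoint_insert_right]
      exact ⟨fun h => hv (Finset.mem_union_left _ (hCA h)), Finset.disjoint_sdiff⟩
    · rw [Finset.union_insert, Finset.union_sdiff_of_subset (hCA.trans Finset.subset_union_left)]
    · intro a ha b hb hab
      rcases Finset.mem_insert.1 hb with rfl | hb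
      · exact hvC a ha hab.symm
      · rw [Finset.mem_sdiff] at hb
        exact hb.2 (hclosed a ha b hb.1 hab)

/-- Seinsche's theorem: a `P₄`-free graph with at least two vertices is a disjoint union or a
join of two smaller graphs. -/
lemma NoInducedPath.split [DecidableEq V] (h : NoInducedPath G) (hX : 1 < X.card) :
    NoEdgeSplit G X ∨ NoEdgeSplit Gᶜ X := by
  induction X using Finset.induction_on with
  | empty => simp at hX
  | insert v X hv ih =>
    by_cases h1 : 1 < X.card
    · rcases ih h1 with h2 | h2
      · exact h.split_insert h2 hv
      · have := h.compl.split_insert h2 hv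
        rw [compl_compl] at this
        exact this.symm
    · rw [Finset.card_insert_of_notMem hv] at hX
      obtain ⟨w, rfl⟩ := Finset.card_eq_one.1 (show X.card = 1 by omega)
      have hvw : v ≠ w := by simpa using hv
      by_cases hadj : G.Adj v w
      · exact Or.inr ⟨{v}, {w}, by simp, by simp, by simpa using hvw, rfl, by simp [hadj]⟩
      · exact Or.inl ⟨{v}, {w}, by simp, by simp, by simpa using hvw, rfl, by simp [hadj]⟩

/-- The graph induced by `G` on `U` has at least `c` connected components. -/
def HasPieces (G : SimpleGraph V) (U : Finset V) (c : ℕ) : Prop :=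
  ∃ f : V → ℕ, (∀ u ∈ U, ∀ v ∈ U, G.Adj u v → f u = f v) ∧ c ≤ (U.image f).card

namespace HasPieces

variable {U U' : Finset V} {c c' : ℕ}

lemma le_card (h : HasPieces G U c) : c ≤ U.card := by
  obtain ⟨f, -, h⟩ := h
  exact h.trans Finset.card_image_le

lemma mono (h : HasPieces G U c) (hc : c' ≤ c) : HasPieces G U c' := by
  obtain ⟨f, h₁, h⟩ := h
  exact ⟨f, h₁, hc.trans h⟩

lemma zero : HasPieces G U 0 := ⟨fun _ => 0, by simp, by simp⟩

lemma one (h : U.Nonempty) : HasPieces G U 1 :=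
  ⟨fun _ => 0, by simp, by simpa [Finset.one_le_card] using h⟩

lemma union [DecidableEq V] (h : HasPieces G U c) (h' : HasPieces G U' c') (hd : Disjoint U U')
    (hU : ∀ u ∈ U, ∀ v ∈ U', ¬ G.Adj u v) : HasPieces G (U ∪ U') (c + c') := by
  obtain ⟨f, hf, hc⟩ := h
  obtain ⟨g, hg, hc'⟩ := h'
  rw [Finset.disjoint_right] at hd
  set φ : V → ℕ := fun v => if v ∈ U then 2 * f v else 2 * g v + 1 with hφ
  have e₁ : ∀ u ∈ U, φ u = 2 * f u := fun u hu => if_pos hu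
  have e₂ : ∀ u ∈ U', φ u = 2 * g u + 1 := fun u hu => if_neg (hd hu)
  refine ⟨φ, ?_, ?_⟩
  · intro u hu v hv huv
    rcases Finset.mem_union.1 hu with hu | hu <;> rcases Finset.mem_union.1 hv with hv | hv
    · rw [e₁ u hu, e₁ v hv, hf u hu v hv huv]
    · exact absurd huv (hU u hu v hv)
    · exact absurd huv.symm (hU v hv u hu)
    · rw [e₂ u hu, e₂ v hv, hg u hu v hv huv]
  · rw [Finset.image_union, Finset.card_union_of_disjoint]
    · have i₁ : U.image φ = (U.image f).image (2 * ·) := by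
        rw [Finset.image_image]
        exact Finset.image_congr e₁
      have i₂ : U'.image φ = (U'.image g).image (2 * · + 1) := by
        rw [Finset.image_image]
        exact Finset.image_congr e₂
      have j₁ : ((U.image f).image (2 * ·)).card = (U.image f).card :=
        Finset.card_image_of_injective _ fun a b h => by simpa using h
      have j₂ : ((U'.image g).image (2 * · + 1)).card = (U'.image g).card :=
        Finset.card_image_of_injective _ fun a b h => by simpa using h
      rw [i₁, i₂]
      omega
    · rw [Finset.disjoint_left]
      simp only [Finset.mem_image]
      rintro _ ⟨u, hu, rfl⟩ ⟨v, hv, h⟩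
      rw [e₁ u hu, e₂ v hv] at h
      omega

end HasPieces

/-- Deleting a set `S` from `X` leaves at most `2 |S| + k` components. -/
def DefectLE [DecidableEq V] (G : SimpleGraph V) (X : Finset V) (k : ℕ) : Prop :=
  ∀ S ⊆ X, ∀ c, HasPieces G (X \ S) c → c ≤ 2 * S.card + k

lemma exists_defect [DecidableEq V] (G : SimpleGraph V) (X : Finset V) :
    ∃ k ≤ X.card, DefectLE G X k ∧ ∃ S ⊆ X, HasPieces G (X \ S) (2 * S.card + k) := by
  classical
  have hcard : DefectLE G X X.card := fun S _ c h =>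
    (h.le_card.trans (Finset.card_le_card Finset.sdiff_subset)).trans (Nat.le_add_left _ _)
  have hex : ∃ k, DefectLE G X k := ⟨_, hcard⟩
  refine ⟨Nat.find hex, Nat.find_min' hex hcard, Nat.find_spec hex, ?_⟩
  rcases Nat.eq_zero_or_pos (Nat.find hex) with h | h
  · exact ⟨∅, by simp, by simpa [h] using HasPieces.zero⟩
  · have := Nat.find_min hex (Nat.sub_one_lt_of_lt h)
    simp only [DefectLE, not_forall] at this
    obtain ⟨S, hS, c, hc, hlt⟩ := this
    exact ⟨S, hS, hc.mono (by omega)⟩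

/-- A version of the path cover formula: a `P₄`-free graph has a cover by `k` hung paths as soon
as no deleted set leaves too many components. -/
lemma NoInducedPath.pathCover [DecidableEq V] (hG : NoInducedPath G) {k : ℕ} (hX : X.Nonempty)
    (hk : k ≤ X.card) (h : DefectLE G X k) : PathCover G Set.univ X k := by
  induction hn : X.card using Nat.strong_induction_on generalizing X k with
  | _ n ih =>
  subst hn
  have hk₁ : 1 ≤ k := by simpa using h ∅ (by simp) 1 (.one (by simpa using hX))
  by_cases hX₁ : X.card = 1
  · obtain ⟨a, rfl⟩ := Finset.card_eq_one.1 hX₁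
    obtain rfl : k = 1 := by omega
    exact .singleton a
  have hX₂ : 1 < X.card := by have := hX.card_pos; omega
  rcases hG.split hX₂ with ⟨A, Y, hA, hY, hd, rfl, hAY⟩ | ⟨A, Y, hA, hY, hd, rfl, hAY⟩
  · have hcard := Finset.card_union_of_disjoint hd
    have hApos := hA.card_pos
    have hYpos := hY.card_pos
    obtain ⟨k₁, hk₁, hd₁, S₁, hS₁, hp₁⟩ := exists_defect G A
    obtain ⟨k₂, hk₂, hd₂, S₂, hS₂, hp₂⟩ := exists_defect G Y
    have c₁ := ih _ (by omega) hA hk₁ hd₁ rfl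
    have c₂ := ih _ (by omega) hY hk₂ hd₂ rfl
    have hp := hp₁.union hp₂ (hd.mono Finset.sdiff_subset Finset.sdiff_subset)
      (fun u hu v hv => hAY u (Finset.sdiff_subset hu) v (Finset.sdiff_subset hv))
    rw [show A \ S₁ ∪ Y \ S₂ = (A ∪ Y) \ (S₁ ∪ S₂) by
      ext z
      have h₁ := @hS₁ z
      have h₂ := @hS₂ z
      have h₃ : z ∈ A → z ∉ Y := fun h => Finset.disjoint_left.1 hd h
      simp only [Finset.mem_union, Finset.mem_sdiff]
      tauto] at hp
    have := h _ (Finset.union_subset_union hS₁ hS₂) _ hp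
    rw [Finset.card_union_of_disjoint (hd.mono hS₁ hS₂)] at this
    exact (c₁.union c₂ hd).of_le (by omega) hk
  · have hadj : ∀ a ∈ A, ∀ b ∈ Y, G.Adj a b := by
      intro a ha b hb
      have := hAY a ha b hb
      rw [compl_adj, not_and, not_not] at this
      exact this fun hab => Finset.disjoint_left.1 hd ha (hab ▸ hb)
    clear hAY
    wlog hle : A.card ≤ Y.card generalizing A Y
    · rw [Finset.union_comm] at hX h hk hX₁ hX₂ ih ⊢
      exact this Y A hY hA hd.symm hX hk h ih hX₁ hX₂ (fun a ha b hb => (hadj b hb a ha).symm)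
        (by omega)
    have hcard := Finset.card_union_of_disjoint hd
    have hApos := hA.card_pos
    have hYpos := hY.card_pos
    obtain ⟨j, hj, hdj, S, hS, hp⟩ := exists_defect G Y
    have c := ih _ (by omega) hY hj hdj rfl
    have hj' : j ≤ 2 * A.card + k := by
      have hAS : Disjoint A S := hd.mono_right hS
      have := h (A ∪ S) (Finset.union_subset_union_right hS) (2 * S.card + j) (by
        rwa [show (A ∪ Y) \ (A ∪ S) = Y \ S by
          ext z
          have h₃ : z ∈ A → z ∉ Y := fun h => Finset.disjoint_left.1 hd h
          simp only [Finset.mem_union, Finset.mem_sdiff]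
          tauto])
      rw [Finset.card_union_of_disjoint hAS] at this
      omega
    by_cases hlt : A.card < Y.card
    · obtain ⟨k', hk'⟩ : ∃ k', k' = min k (Y.card - A.card) := ⟨_, rfl⟩
      obtain ⟨i, hi⟩ : ∃ i, i = max j (A.card + k') := ⟨_, rfl⟩
      have c₂ := (c.of_le (m := k' + (i - k')) (by omega) (by omega)).of_subset (E' := Y) subset_rfl
      exact ((c₂.union_of_forall_adj hd hadj (by omega) (by omega) (by omega)).mono
        (Set.subset_univ _)).of_le (by omega) hk
    · obtain ⟨a, ha⟩ := hA
      have hcA := Finset.card_erase_of_mem ha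
      have c₂ := (c.of_le (m := 1 + (A.erase a).card) (by omega) (by omega)).of_subset (E' := Y)
        subset_rfl
      have c₃ := c₂.union_of_forall_adj (A := A.erase a)
        (hd.mono_left (Finset.erase_subset _ _))
        (fun b hb => hadj b (Finset.mem_of_mem_erase hb)) (by omega) le_rfl (by omega)
      have c₄ := c₃.insert_one (k := 0) (a := a)
        (by simp [Finset.disjoint_left.1 hd ha]) (hadj a ha)
      rw [← Finset.insert_union, Finset.insert_erase ha] at c₄
      exact c₄.of_le hk₁ hk

end

lemma exists_isCompOf [Finite V] (G : SimpleGraph V) {S : Set V} {v : V} (hv : v ∉ S) :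
    ∃ R, v ∈ R ∧ IsCompOf G S R := by
  have h₀ : ({v} : Set V) ⊆ Sᶜ ∧ (G.induce ({v} : Set V)).Connected :=
    ⟨by simpa using hv, by
      have : Subsingleton ({v} : Set V) := by simp
      exact ⟨.of_subsingleton⟩⟩
  obtain ⟨R, hvR, hR⟩ := Finite.exists_le_maximal
    (p := fun R : Set V => R ⊆ Sᶜ ∧ (G.induce R).Connected) h₀
  exact ⟨R, hvR rfl, hR.1.1, hR.1.2, fun R' hRR' h h' =>
    (hR.2 ⟨h, h'⟩ hRR').antisymm hRR'⟩

lemma IsCompOf.eq_of_mem {G : SimpleGraph V} {S R R' : Set V} (h : IsCompOf G S R)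
    (h' : IsCompOf G S R') {x : V} (hx : x ∈ R) (hx' : x ∈ R') : R = R' := by
  have hc := induce_union_connected h.2.1.preconnected h'.2.1.preconnected ⟨x, hx, hx'⟩
  have hs := Set.union_subset h.1 h'.1
  exact (h.2.2 _ Set.subset_union_left hs hc).symm.trans (h'.2.2 _ Set.subset_union_right hs hc)

lemma IsCompOf.mem_of_adj {G : SimpleGraph V} {S R : Set V} (h : IsCompOf G S R) {x y : V}
    (hx : x ∈ R) (hxy : G.Adj x y) (hy : y ∉ S) : y ∈ R := by
  have hc := induce_union_connected h.2.1.preconnected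
    (induce_pair_connected_of_adj hxy).preconnected ⟨x, hx, by simp⟩
  rw [← h.2.2 _ Set.subset_union_left (Set.union_subset h.1 ?_) hc]
  · simp
  · rintro z (rfl | rfl)
    exacts [h.1 hx, hy]

lemma HasPieces.le_numComp [Fintype V] [DecidableEq V] {G : SimpleGraph V} {S : Finset V} {c : ℕ}
    (h : HasPieces G (Finset.univ \ S) c) : c ≤ numComp G S := by
  obtain ⟨f, hf, hc⟩ := h
  refine hc.trans ?_
  have hex : ∀ i ∈ (Finset.univ \ S).image f, ∃ R, IsCompOf G S R ∧ ∀ v ∈ R, f v = i := by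
    intro i hi
    obtain ⟨v, hv, rfl⟩ := Finset.mem_image.1 hi
    obtain ⟨R, hvR, hR⟩ := exists_isCompOf G (S := S) (v := v) (by simpa using hv)
    refine ⟨R, hR, fun w hw => ?_⟩
    by_contra hne
    have hcut := (cutConn_iff G R).2 hR.2.1.preconnected
    obtain ⟨a, ha, b, hb, haD, hbD, hab⟩ := hcut {z | f z = f v} ⟨v, hvR, rfl⟩ ⟨w, hw, hne⟩
    refine hbD ((hf b ?_ a ?_ hab.symm).trans haD)
    · simpa using hR.1 hb
    · simpa using hR.1 ha
  choose! R hR hRf using hex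
  rw [← Set.ncard_coe_finset, numComp]
  refine Set.ncard_le_ncard_of_injOn R (fun i hi => hR i hi) (fun i hi j hj hij => ?_)
    (Set.toFinite _)
  obtain ⟨⟨x, hx⟩⟩ := (hR i hi).2.1.nonempty
  rw [← hRf i hi x hx, hRf j hj x (hij ▸ hx)]

lemma PathCover.eq_empty [DecidableEq V] {G : SimpleGraph V} {E : Set V} {X : Finset V}
    (h : PathCover G E X 0) : X = ∅ := by
  cases h; rfl

lemma exists_isSBEP_of_tough [Fintype V] {G : SimpleGraph V} (hcard : 2 ≤ Fintype.card V)
    (hconn : G.Connected) (hP4 : P4Free G) (ht : Tough (1 / 2 : ℝ) G) :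
    ∃ H : SimpleGraph V, H ≤ G ∧ IsSBEP H := by
  classical
  have : Nontrivial V := Fintype.one_lt_card_iff_nontrivial.1 hcard
  suffices ∃ F, HasSBEPOn G Set.univ F by
    obtain ⟨F, H, 𝓑, hle, hB⟩ := this
    exact ⟨H, hle, hB.isSBEP⟩
  have ht' : ∀ S : Finset V, ∀ c, HasPieces G (Finset.univ \ S) c → c ≤ 2 * S.card ∨ c ≤ 1 := by
    intro S c hc
    by_cases h2 : 2 ≤ numComp G S
    · have := ht S h2
      rw [Set.ncard_coe_finset] at this
      have h3 : (numComp G S : ℝ) ≤ ((2 * S.card : ℕ) : ℝ) := by push_cast; linarith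
      exact Or.inl (hc.le_numComp.trans (by exact_mod_cast h3))
    · exact Or.inr (hc.le_numComp.trans (by omega))
  have hG := hP4.noInducedPath
  rcases hG.split (X := Finset.univ) (by rwa [Finset.card_univ]) with
    ⟨A, Y, ⟨a, ha⟩, ⟨y, hy⟩, hd, hAY, hnadj⟩ | ⟨A, Y, hA, hY, hd, hAY, hnadj⟩
  · obtain ⟨u, v, hu, hv, huv⟩ := (preconnected_iff_exists_adj_crossing G).1 hconn.preconnected A
      ⟨a, ha⟩ ⟨y, fun h => Finset.disjoint_left.1 hd h hy⟩
    have hvY : v ∈ A ∪ Y := hAY ▸ Finset.mem_univ v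
    exact absurd huv (hnadj u hu v ((Finset.mem_union.1 hvY).resolve_left hv))
  have hadj : ∀ a ∈ A, ∀ b ∈ Y, G.Adj a b := by
    intro a ha b hb
    have := hnadj a ha b hb
    rw [compl_adj, not_and, not_not] at this
    exact this fun hab => Finset.disjoint_left.1 hd ha (hab ▸ hb)
  clear hnadj
  wlog hle : A.card ≤ Y.card generalizing A Y
  · exact this Y A hY hA hd.symm (by rwa [Finset.union_comm])
      (fun a ha b hb => (hadj b hb a ha).symm) (by omega)
  have hApos := hA.card_pos
  obtain ⟨j, hj, hdj, S, hS, hp⟩ := exists_defect G Y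
  have hj' : j ≤ 2 * A.card := by
    have hAS : Disjoint A S := hd.mono_right hS
    have := ht' (A ∪ S) (2 * S.card + j) (by
      rwa [← hAY, show (A ∪ Y) \ (A ∪ S) = Y \ S by
        ext z
        have h₃ : z ∈ A → z ∉ Y := fun h => Finset.disjoint_left.1 hd h
        simp only [Finset.mem_union, Finset.mem_sdiff]
        tauto])
    rw [Finset.card_union_of_disjoint hAS] at this
    omega
  obtain ⟨i, hi⟩ : ∃ i, i = max j A.card := ⟨_, rfl⟩
  have c := ((hG.pathCover hY hj hdj).of_le (m := i) (by omega) (by omega)).of_subset (E' := Y)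
    subset_rfl
  obtain ⟨a, ha⟩ := hA
  have hcA := Finset.card_erase_of_mem ha
  have haY : a ∉ A.erase a ∪ Y := by simp [Finset.disjoint_left.1 hd ha]
  have hins : insert a (A.erase a ∪ Y) = Finset.univ := by
    rw [← Finset.insert_union, Finset.insert_erase ha, hAY]
  have hdA : Disjoint (A.erase a) Y := hd.mono_left (Finset.erase_subset _ _)
  have hadjA : ∀ b ∈ A.erase a, ∀ y ∈ (Y : Set V), G.Adj b y :=
    fun b hb => hadj b (Finset.mem_of_mem_erase hb)
  by_cases hi2 : i < 2 * A.card
  · rw [show i = 1 + (i - 1) by omega] at c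
    have c₂ := c.union_of_forall_adj hdA hadjA (by omega) (by omega) (by omega)
    generalize A.erase a ∪ Y = X at c₂ haY hins
    cases c₂ with
    | @cons U X x y n _ h hn hx hy hX hd =>
    obtain rfl := hX.eq_empty
    rw [Finset.union_empty] at hins haY
    refine ⟨{a}, ?_⟩
    have := h.hasSBEPOn hn haY (hadj a ha x hx) (hadj a ha y hy)
    rwa [← Finset.coe_insert, hins, Finset.coe_univ] at this
  · rw [show i = 2 + (2 * A.card - 2) by omega] at c
    have c₂ := c.union_of_forall_adj hdA hadjA (by omega) (by omega) (by omega)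
    generalize A.erase a ∪ Y = X at c₂ haY hins
    cases c₂ with
    | @cons U₁ _ x y n _ h₁ hn₁ hx₁ hy₁ h hd₁ =>
    cases h with
    | @cons U₂ X z w m _ h₂ hn₂ hx₂ hy₂ hX hd₂ =>
    obtain rfl := hX.eq_empty
    rw [Finset.union_empty] at hins haY hd₁
    rw [Finset.mem_union, not_or] at haY
    have := (h₁.hasSBEPOn hn₁ haY.1 (hadj a ha _ hx₁) (hadj a ha _ hy₁)).glue (v := a)
      (h₂.hasSBEPOn hn₂ haY.2 (hadj a ha _ hx₂) (hadj a ha _ hy₂)) (by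
        rw [← Set.insert_inter_distrib, ← Finset.coe_inter,
          Finset.disjoint_iff_inter_eq_empty.1 hd₁]
        simp) rfl rfl (by simp)
    rw [← Set.insert_union_distrib, ← Finset.coe_union, ← Finset.coe_insert, hins,
      Finset.coe_univ] at this
    exact ⟨_, this⟩

lemma exists_isBlock_of_adj [Finite V] {H : SimpleGraph V} {u v : V} (h : H.Adj u v) :
    ∃ B : H.Subgraph, IsBlock H B ∧ B.Adj u v := by
  obtain ⟨B, hle, hB⟩ := Finite.exists_le_maximal
    (p := fun B : H.Subgraph => B.coe.Connected ∧ ∀ v, ¬ IsCutvertex B.coe v)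
    ⟨(Subgraph.subgraphOfAdj_connected h).coe, not_isCutvertex_subgraphOfAdj h⟩
  refine ⟨B, ⟨hB.1.1, hB.1.2, fun B' hBB' h₁ h₂ => (hB.2 ⟨h₁, h₂⟩ hBB').antisymm hBB'⟩, ?_⟩
  exact hle.2 (by simp)

/-- In an even cycle or a single edge, the neighbors of `s` are among two vertices `p`, `q`, which
coincide unless there are at least three vertices. -/
lemma exists_two_neighbors {K : SimpleGraph W} (hK : IsEvenCycleGraph K ∨ IsSingleEdgeGraph K)
    (s : W) : ∃ p q : W, (∀ u, K.Adj s u → u = p ∨ u = q) ∧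
      (p = q ∨ ∀ u, ∃ z, z ≠ s ∧ z ≠ u) := by
  rcases hK with ⟨n, -, hn, ⟨e⟩⟩ | ⟨a, b, hab, -, hw⟩
  · obtain ⟨m, rfl⟩ : ∃ m, n = m + 2 := ⟨n - 2, by omega⟩
    refine ⟨e.symm (e s - 1), e.symm (e s + 1), fun u hu => ?_, Or.inr fun u => ?_⟩
    · have : e u ∈ (cycleGraph (m + 2)).neighborSet (e s) := e.map_adj_iff.2 hu
      rw [cycleGraph_neighborSet] at this
      rcases this with h | h
      · exact Or.inl (by rw [← h]; simp)
      · exact Or.inr (by rw [← h]; simp)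
    · obtain ⟨z, hz⟩ := Finset.exists_mem_notMem_of_card_lt_card
        (s := ({e s, e u} : Finset (Fin (m + 2)))) (t := Finset.univ)
        (Finset.card_le_two.trans_lt (by simp; omega))
      simp only [Finset.mem_univ, Finset.mem_insert, Finset.mem_singleton, not_or, true_and] at hz
      refine ⟨e.symm z, fun h => hz.1 ?_, fun h => hz.2 ?_⟩ <;> simp [← h]
  · rcases hw s with rfl | rfl
    · exact ⟨b, b, fun u hu => Or.inl ((hw u).resolve_left hu.ne'), Or.inl rfl⟩
    · exact ⟨a, a, fun u hu => Or.inl ((hw u).resolve_right hu.ne'), Or.inl rfl⟩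

/-- All neighbors of a vertex of an SBEP graph can be listed in four slots, where each of them
occurs twice or lies in a common block with that vertex and a third one. -/
lemma IsSBEP.exists_slots [Finite V] {H : SimpleGraph V} (hH : IsSBEP H) (s : V) :
    ∃ f : Fin 4 → V, ∀ u, H.Adj s u → ∃ i, f i = u ∧ ((∃ j ≠ i, f j = u) ∨
      ∃ N, NonSep H N ∧ s ∈ N ∧ u ∈ N ∧ ∃ z ∈ N, z ≠ s ∧ z ≠ u) := by
  have hblock : ∀ B : H.Subgraph, IsBlock H B → s ∈ B.verts → ∃ p q : V,
      ∀ u, B.Adj s u → (u = p ∨ u = q) ∧ (p = q ∨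
        ∃ N, NonSep H N ∧ s ∈ N ∧ u ∈ N ∧ ∃ z ∈ N, z ≠ s ∧ z ≠ u) := by
    intro B hB hs
    obtain ⟨p, q, hpq, h3⟩ := exists_two_neighbors (hH.2.1 B hB) ⟨s, hs⟩
    refine ⟨p, q, fun u hu => ⟨?_, ?_⟩⟩
    · rcases hpq ⟨u, B.edge_vert hu.symm⟩ (by simpa using hu) with h | h
      · exact Or.inl (congrArg Subtype.val h)
      · exact Or.inr (congrArg Subtype.val h)
    · refine h3.imp (congrArg Subtype.val) fun h => ?_
      obtain ⟨z, hzs, hzu⟩ := h ⟨u, B.edge_vert hu.symm⟩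
      exact ⟨B.verts, .of_coe hB.1.preconnected hB.2.1, hs, B.edge_vert hu.symm, z, z.2,
        fun h => hzs (Subtype.ext h), fun h => hzu (Subtype.ext h)⟩
  obtain ⟨B₁, B₂, hB⟩ : ∃ B₁ B₂ : H.Subgraph, ∀ B, IsBlock H B ∧ s ∈ B.verts →
      (IsBlock H B₁ ∧ s ∈ B₁.verts) ∧ (IsBlock H B₂ ∧ s ∈ B₂.verts) ∧ (B = B₁ ∨ B = B₂) := by
    by_cases h₁ : ∃ B₁ : H.Subgraph, IsBlock H B₁ ∧ s ∈ B₁.verts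
    · obtain ⟨B₁, h₁⟩ := h₁
      by_cases h₂ : ∃ B₂ : H.Subgraph, (IsBlock H B₂ ∧ s ∈ B₂.verts) ∧ B₂ ≠ B₁
      · obtain ⟨B₂, h₂, hne⟩ := h₂
        refine ⟨B₁, B₂, fun B h => ⟨h₁, h₂, ?_⟩⟩
        have := hH.2.2 s B B₁ B₂ h h₁ h₂
        tauto
      · push Not at h₂
        exact ⟨B₁, B₁, fun B h => ⟨h₁, h₁, Or.inl (h₂ B h)⟩⟩
    · exact ⟨⊥, ⊥, fun B h => absurd ⟨B, h⟩ h₁⟩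
  by_cases hadj : ∃ u, H.Adj s u
  · obtain ⟨u, hu⟩ := hadj
    obtain ⟨B, hB₀, hBu⟩ := exists_isBlock_of_adj hu
    obtain ⟨h₁, h₂, -⟩ := hB B ⟨hB₀, B.edge_vert hBu⟩
    obtain ⟨p₁, q₁, hpq₁⟩ := hblock B₁ h₁.1 h₁.2
    obtain ⟨p₂, q₂, hpq₂⟩ := hblock B₂ h₂.1 h₂.2
    refine ⟨![p₁, q₁, p₂, q₂], fun u hu => ?_⟩
    obtain ⟨B, hB₀, hBu⟩ := exists_isBlock_of_adj hu
    rcases (hB B ⟨hB₀, B.edge_vert hBu⟩).2.2 with rfl | rfl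
    · obtain ⟨rfl | rfl, h⟩ := hpq₁ u hBu
      · exact ⟨0, rfl, h.imp_left fun h => ⟨1, by decide, h.symm⟩⟩
      · exact ⟨1, rfl, h.imp_left fun h => ⟨0, by decide, h⟩⟩
    · obtain ⟨rfl | rfl, h⟩ := hpq₂ u hBu
      · exact ⟨2, rfl, h.imp_left fun h => ⟨3, by decide, h.symm⟩⟩
      · exact ⟨3, rfl, h.imp_left fun h => ⟨2, by decide, h⟩⟩
  · exact ⟨fun _ => s, fun u hu => absurd ⟨u, hu⟩ hadj⟩

lemma IsSBEP.tough [Finite V] {G H : SimpleGraph V} (hle : H ≤ G) (hH : IsSBEP H) :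
    Tough (1 / 2 : ℝ) G := by
  classical
  have := Fintype.ofFinite V
  intro S hS
  choose f hf using hH.exists_slots
  have hcomp : ∀ R, IsCompOf G S R → ∃ a b : V × Fin 4, a ≠ b ∧ a.1 ∈ S ∧ b.1 ∈ S ∧
      f a.1 a.2 ∈ R ∧ f b.1 b.2 ∈ R := by
    intro R hR
    obtain ⟨R₁, h₁, R₂, h₂, h₁₂⟩ := (Set.one_lt_ncard (Set.toFinite _)).1 hS
    obtain ⟨R', hR', hne⟩ : ∃ R', IsCompOf G S R' ∧ R' ≠ R := by
      by_cases h : R₁ = R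
      · exact ⟨R₂, h₂, fun h' => h₁₂ (h.trans h'.symm)⟩
      · exact ⟨R₁, h₁, h⟩
    obtain ⟨⟨x, hx⟩⟩ := hR.2.1.nonempty
    obtain ⟨⟨y, hy⟩⟩ := hR'.2.1.nonempty
    have hS' : ∀ x ∈ R, ∀ y ∉ R, H.Adj x y → y ∈ S := fun x hx y hy hxy => by
      by_contra h
      exact hy (hR.mem_of_adj hx (hle hxy) h)
    obtain ⟨x, s, hx, hs, hxs⟩ := (preconnected_iff_exists_adj_crossing H).1 hH.1.preconnected R
      ⟨x, hx⟩ ⟨y, fun h => hne (hR'.eq_of_mem hR hy h)⟩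
    have hsS := hS' x hx s hs hxs
    obtain ⟨i, hi, ⟨j, hji, hj⟩ | ⟨N, hN, hsN, hxN, z, hz, hzs, hzx⟩⟩ := hf s x hxs.symm
    · exact ⟨(s, i), (s, j), fun h => hji (congrArg Prod.snd h).symm, hsS, hsS, by simpa [hi],
        by simpa [hj]⟩
    by_cases hzR : z ∈ R
    · obtain ⟨a, ha, b, hb, haR, hbR, hab⟩ := hN.2 x R ⟨z, ⟨hz, hzx⟩, hzR⟩
        ⟨s, ⟨hsN, hxs.ne'⟩, hs⟩
      obtain ⟨j, hj, -⟩ := hf b a hab.symm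
      refine ⟨(s, i), (b, j), ?_, hsS, hS' a haR b hbR hab, by simpa [hi], by simpa [hj]⟩
      intro h
      rw [Prod.mk.injEq] at h
      obtain ⟨rfl, rfl⟩ := h
      exact ha.2 (hj.symm.trans hi)
    · obtain ⟨a, ha, b, hb, haR, hbR, hab⟩ := hN.2 s R ⟨x, ⟨hxN, hxs.ne⟩, hx⟩ ⟨z, ⟨hz, hzs⟩, hzR⟩
      obtain ⟨j, hj, -⟩ := hf b a hab.symm
      exact ⟨(s, i), (b, j), fun h => hb.2 (congrArg Prod.fst h).symm, hsS, hS' a haR b hbR hab,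
        by simpa [hi], by simpa [hj]⟩
  have := hH.1.nonempty
  choose! a b hab haS hbS haR hbR using hcomp
  have key : ((Set.toFinset {R | IsCompOf G S R}) ×ˢ (Finset.univ : Finset Bool)).card ≤
      (S.toFinset ×ˢ (Finset.univ : Finset (Fin 4))).card := by
    refine Finset.card_le_card_of_injOn (fun p => if p.2 then a p.1 else b p.1) ?_ ?_
    · rintro ⟨R, c⟩ hRc
      have hR : IsCompOf G S R := by simpa using hRc
      cases c
      · simpa using hbS R hR
      · simpa using haS R hR
    · have hmem : ∀ R, IsCompOf G S R → ∀ c : Bool,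
          f (if c then a R else b R).1 (if c then a R else b R).2 ∈ R := by
        rintro R hR (_ | _)
        · exact hbR R hR
        · exact haR R hR
      rintro ⟨R, c⟩ hR ⟨R', c'⟩ hR' h
      have hR : IsCompOf G S R := by simpa using hR
      have hR' : IsCompOf G S R' := by simpa using hR'
      dsimp only at h
      have h₂ := hmem R' hR' c'
      rw [← h] at h₂
      obtain rfl := hR.eq_of_mem hR' (hmem R hR c) h₂
      have hne := hab R hR
      cases c <;> cases c' <;> first | rfl | exact absurd h hne | exact absurd h.symm hne
  rw [Finset.card_product, Finset.card_product, ← Set.ncard_eq_toFinset_card',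
    ← Set.ncard_eq_toFinset_card'] at key
  simp only [Finset.card_univ, Fintype.card_bool, Fintype.card_fin] at key
  have : (numComp G S * 2 : ℝ) ≤ S.ncard * 4 := by exact_mod_cast key
  linarith

/-- A connected `P₄`-free graph with at least two vertices has a
spanning SBEP subgraph if and only if it is `1/2`-tough. -/
theorem stmt_18 {V : Type*} [Fintype V] (G : SimpleGraph V)
    (hcard : 2 ≤ Fintype.card V) (hconn : G.Connected) (hP4 : P4Free G) :
    (∃ H : SimpleGraph V, H ≤ G ∧ IsSBEP H) ↔ Tough (1 / 2 : ℝ) G := by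
  refine ⟨?_, exists_isSBEP_of_tough hcard hconn hP4⟩
  rintro ⟨H, hle, hH⟩
  exact hH.tough hle
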